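/- Let m, q∞ > 0, ϑ₀ ∈ (0, π/2), and let ϑ, p*, q* be as defined. Then as t → ∞: ϑ(t) = O(1/(1+t)); there exists P₀ = lim_{t→∞}(p*(t) − m t/(2q∞)) such that p*(t) = P₀ + m t/(2q∞) + O(1/(t+1)); and q*(t) = q∞ + O(1/(t+1)²). Consequently there is a constant C₁ > 0 with ‖(t+1)^{−1} p*‖_{L∞[0,∞)} + ‖ṗ*‖_{L∞[0,∞)} ≤ C₁ and ‖q*‖_{L∞[0,∞)} + ‖(t+1)³ q̇*‖_{L∞[0,∞)} ≤ C₁. -/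

import Mathlib

open MeasureTheory Metric Real Filter Topology Set

noncomputable section

/-- `arccot`, with values in `(0, π)`. -/
def arccotR (x : ℝ) : ℝ := π / 2 - Real.arctan x

/-- The explicit angle `ϑ(t) = (1/2)·arccot(cot(2ϑ₀) + m t/(4q∞²))`. -/
def thetaF (m qinf ϑ₀ t : ℝ) : ℝ :=
  (1 / 2) * arccotR (Real.cot (2 * ϑ₀) + m * t / (4 * qinf ^ 2))

/-- `p*(t) = q∞ / sin ϑ(t)`. -/
def pstarF (m qinf ϑ₀ t : ℝ) : ℝ := qinf / Real.sin (thetaF m qinf ϑ₀ t)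

/-- `q*(t) = q∞ / cos ϑ(t)`. -/
def qstarF (m qinf ϑ₀ t : ℝ) : ℝ := qinf / Real.cos (thetaF m qinf ϑ₀ t)

/-- `r(t) = 2q∞ / sin(2ϑ(t))`, so that `p* + i q* = r e^{iϑ}`. -/
def rstarF (m qinf ϑ₀ t : ℝ) : ℝ := 2 * qinf / Real.sin (2 * thetaF m qinf ϑ₀ t)

/-- The point-vortex nonlinearity `F(x,y) = (m/2)(1/x − x/(x²+y²))`. -/
def Fpv (m x y : ℝ) : ℝ := (m / 2) * (1 / x - x / (x ^ 2 + y ^ 2))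

theorem arccotR_mem_Ioo (x : ℝ) : arccotR x ∈ Ioo (0 : ℝ) π := by
  unfold arccotR
  constructor <;> linarith [Real.arctan_lt_pi_div_two x, Real.neg_pi_div_two_lt_arctan x]

theorem sin_arccotR_sq (x : ℝ) : Real.sin (arccotR x) ^ 2 = 1 / (1 + x ^ 2) := by
  rw [arccotR, Real.sin_pi_div_two_sub, Real.cos_sq_arctan]

theorem cos_arccotR (x : ℝ) : Real.cos (arccotR x) = x * Real.sin (arccotR x) := by
  rw [arccotR, Real.sin_pi_div_two_sub, Real.cos_pi_div_two_sub]
  conv_rhs => rw [← Real.tan_arctan x, Real.arctan_tan (Real.neg_pi_div_two_lt_arctan x)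
    (Real.arctan_lt_pi_div_two x)]
  rw [Real.tan_mul_cos (Real.cos_arctan_pos x).ne']

theorem thetaF_mem_Ioo (m qinf ϑ₀ t : ℝ) : thetaF m qinf ϑ₀ t ∈ Ioo (0 : ℝ) (π / 2) := by
  obtain ⟨h₀, h₁⟩ := arccotR_mem_Ioo (Real.cot (2 * ϑ₀) + m * t / (4 * qinf ^ 2))
  unfold thetaF
  constructor <;> linarith

theorem sin_thetaF_pos (m qinf ϑ₀ t : ℝ) : 0 < Real.sin (thetaF m qinf ϑ₀ t) := by
  obtain ⟨h₀, h₁⟩ := thetaF_mem_Ioo m qinf ϑ₀ t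
  exact Real.sin_pos_of_pos_of_lt_pi h₀ (by linarith [Real.pi_pos])

theorem cos_thetaF_pos (m qinf ϑ₀ t : ℝ) : 0 < Real.cos (thetaF m qinf ϑ₀ t) := by
  obtain ⟨h₀, h₁⟩ := thetaF_mem_Ioo m qinf ϑ₀ t
  exact Real.cos_pos_of_mem_Ioo ⟨by linarith, h₁⟩

theorem two_mul_thetaF (m qinf ϑ₀ t : ℝ) :
    2 * thetaF m qinf ϑ₀ t = arccotR (Real.cot (2 * ϑ₀) + m * t / (4 * qinf ^ 2)) := by
  unfold thetaF
  ring

/-- The double-angle relation `cos² ϑ - sin² ϑ = 2 cot(2ϑ) sin ϑ cos ϑ` along the trajectory. -/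
theorem cos_sq_sub_sin_sq_thetaF (m qinf ϑ₀ t : ℝ) :
    Real.cos (thetaF m qinf ϑ₀ t) ^ 2 - Real.sin (thetaF m qinf ϑ₀ t) ^ 2 =
      2 * (Real.cot (2 * ϑ₀) + m * t / (4 * qinf ^ 2)) *
        (Real.sin (thetaF m qinf ϑ₀ t) * Real.cos (thetaF m qinf ϑ₀ t)) := by
  have h := cos_arccotR (Real.cot (2 * ϑ₀) + m * t / (4 * qinf ^ 2))
  rw [← two_mul_thetaF, Real.cos_two_mul', Real.sin_two_mul] at h
  linear_combination h

theorem hasDerivAt_thetaF (m qinf ϑ₀ t : ℝ) :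
    HasDerivAt (thetaF m qinf ϑ₀)
      (-(2 * (m / (4 * qinf ^ 2)) *
        (Real.sin (thetaF m qinf ϑ₀ t) * Real.cos (thetaF m qinf ϑ₀ t)) ^ 2)) t := by
  have hlin : HasDerivAt (fun t : ℝ => Real.cot (2 * ϑ₀) + m * t / (4 * qinf ^ 2))
      (m * 1 / (4 * qinf ^ 2)) t :=
    (((hasDerivAt_id t).const_mul m).div_const _).const_add _
  have h := (hlin.arctan.const_sub (π / 2)).const_mul (1 / 2)
  have hs := sin_arccotR_sq (Real.cot (2 * ϑ₀) + m * t / (4 * qinf ^ 2))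
  rw [← two_mul_thetaF, Real.sin_two_mul] at hs
  refine h.congr_deriv ?_
  rw [← hs]
  ring

theorem hasDerivAt_pstarF (m qinf ϑ₀ t : ℝ) :
    HasDerivAt (pstarF m qinf ϑ₀)
      (2 * (m / (4 * qinf ^ 2)) * qinf * Real.cos (thetaF m qinf ϑ₀ t) ^ 3) t := by
  have hs := (sin_thetaF_pos m qinf ϑ₀ t).ne'
  refine ((hasDerivAt_const t qinf).fun_div (hasDerivAt_thetaF m qinf ϑ₀ t).sin hs).congr_deriv ?_
  generalize m / (4 * qinf ^ 2) = a
  field_simp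
  ring

theorem hasDerivAt_qstarF (m qinf ϑ₀ t : ℝ) :
    HasDerivAt (qstarF m qinf ϑ₀)
      (-(2 * (m / (4 * qinf ^ 2)) * qinf * Real.sin (thetaF m qinf ϑ₀ t) ^ 3)) t := by
  have hc := (cos_thetaF_pos m qinf ϑ₀ t).ne'
  refine ((hasDerivAt_const t qinf).fun_div (hasDerivAt_thetaF m qinf ϑ₀ t).cos hc).congr_deriv ?_
  generalize m / (4 * qinf ^ 2) = a
  field_simp
  ring

theorem tan_thetaF_pos (m qinf ϑ₀ t : ℝ) : 0 < Real.tan (thetaF m qinf ϑ₀ t) := by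
  rw [Real.tan_eq_sin_div_cos]
  exact div_pos (sin_thetaF_pos m qinf ϑ₀ t) (cos_thetaF_pos m qinf ϑ₀ t)

theorem sin_thetaF_le_tan (m qinf ϑ₀ t : ℝ) :
    Real.sin (thetaF m qinf ϑ₀ t) ≤ Real.tan (thetaF m qinf ϑ₀ t) := by
  rw [Real.tan_eq_sin_div_cos]
  exact le_div_self (sin_thetaF_pos m qinf ϑ₀ t).le (cos_thetaF_pos m qinf ϑ₀ t)
    (Real.cos_le_one _)

theorem tan_thetaF_le {m qinf : ℝ} (hm : 0 < m) (hq : 0 < qinf) (ϑ₀ : ℝ) {t : ℝ} (ht : 0 ≤ t) :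
    Real.tan (thetaF m qinf ϑ₀ t) ≤
      (1 + (m / (4 * qinf ^ 2) - Real.cot (2 * ϑ₀)) ^ 2) / (2 * (m / (4 * qinf ^ 2))) /
        (t + 1) := by
  have ha : 0 < m / (4 * qinf ^ 2) := by positivity
  have hc := cos_thetaF_pos m qinf ϑ₀ t
  have h := cos_sq_sub_sin_sq_thetaF m qinf ϑ₀ t
  have hu : Real.sin (thetaF m qinf ϑ₀ t) =
      Real.tan (thetaF m qinf ϑ₀ t) * Real.cos (thetaF m qinf ϑ₀ t) :=
    (Real.tan_mul_cos hc.ne').symm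
  have hat : m * t / (4 * qinf ^ 2) = m / (4 * qinf ^ 2) * t := by ring
  rw [hu, hat] at h
  generalize m / (4 * qinf ^ 2) = a at *
  generalize Real.cot (2 * ϑ₀) = c at *
  generalize Real.tan (thetaF m qinf ϑ₀ t) = u at *
  have h' : 1 - u ^ 2 = 2 * (c + a * t) * u :=
    mul_right_cancel₀ (pow_pos hc 2).ne' (by linear_combination h)
  rw [div_div, le_div_iff₀ (by positivity)]
  linarith [sq_nonneg (u - (a - c))]

theorem abs_pstarF_sub_le {qinf : ℝ} (hq : 0 < qinf) (m ϑ₀ t : ℝ) :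
    |pstarF m qinf ϑ₀ t - (2 * qinf * Real.cot (2 * ϑ₀) + m * t / (2 * qinf))| ≤
      2 * qinf * Real.tan (thetaF m qinf ϑ₀ t) := by
  have hc := cos_thetaF_pos m qinf ϑ₀ t
  have hs := sin_thetaF_pos m qinf ϑ₀ t
  have h := cos_sq_sub_sin_sq_thetaF m qinf ϑ₀ t
  have hlin : 2 * qinf * Real.cot (2 * ϑ₀) + m * t / (2 * qinf) =
      2 * qinf * (Real.cot (2 * ϑ₀) + m * t / (4 * qinf ^ 2)) := by
    field_simp
    ring
  have hsc := Real.sin_sq_add_cos_sq (thetaF m qinf ϑ₀ t)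
  have hc1 := Real.cos_le_one (thetaF m qinf ϑ₀ t)
  rw [hlin, pstarF, Real.tan_eq_sin_div_cos]
  generalize Real.cot (2 * ϑ₀) + m * t / (4 * qinf ^ 2) = c at *
  generalize Real.sin (thetaF m qinf ϑ₀ t) = s at *
  generalize Real.cos (thetaF m qinf ϑ₀ t) = k at *
  have heq : qinf / s - 2 * qinf * c = qinf * ((k * (1 - k) + s ^ 2) / (s * k)) := by
    field_simp
    linear_combination h
  have hk : 0 ≤ 1 - k := sub_nonneg.2 hc1
  rw [heq, abs_of_nonneg (by positivity), mul_comm 2 qinf, mul_assoc]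
  refine mul_le_mul_of_nonneg_left ?_ hq.le
  rw [← mul_div_assoc, div_le_div_iff₀ (by positivity) hc]
  have hle : k * (1 - k) ≤ s ^ 2 := by nlinarith
  nlinarith

theorem abs_qstarF_sub_le {qinf : ℝ} (hq : 0 < qinf) (m ϑ₀ t : ℝ) :
    |qstarF m qinf ϑ₀ t - qinf| ≤ qinf * Real.tan (thetaF m qinf ϑ₀ t) ^ 2 := by
  have hc := cos_thetaF_pos m qinf ϑ₀ t
  have hsc := Real.sin_sq_add_cos_sq (thetaF m qinf ϑ₀ t)
  have hc1 := Real.cos_le_one (thetaF m qinf ϑ₀ t)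
  rw [qstarF, Real.tan_eq_sin_div_cos]
  generalize Real.sin (thetaF m qinf ϑ₀ t) = s at *
  generalize Real.cos (thetaF m qinf ϑ₀ t) = k at *
  have heq : qinf / k - qinf = qinf * ((1 - k) / k) := by
    field_simp
  have hk : 0 ≤ 1 - k := sub_nonneg.2 hc1
  rw [heq, abs_of_nonneg (by positivity), div_pow]
  refine mul_le_mul_of_nonneg_left ?_ hq.le
  rw [div_le_div_iff₀ hc (by positivity)]
  have hle : (1 - k) * k ≤ s ^ 2 := by nlinarith
  nlinarith

/-- asymptotics of the explicit trajectory as `t → ∞`: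
`ϑ(t) = O(1/(1+t))`, `p*(t) = P₀ + mt/(2q∞) + O(1/(t+1))` for some limit `P₀`, and
`q*(t) = q∞ + O(1/(t+1)²)`; consequently the stated weighted `L∞` bounds hold on
`[0,∞)` with an absolute constant `C₁`. -/
theorem statement_7 (m qinf ϑ₀ : ℝ) (hm : 0 < m) (hq : 0 < qinf)
    (hϑ : ϑ₀ ∈ Ioo (0:ℝ) (π / 2)) :
    ∃ C₁ > 0, ∃ P₀ : ℝ,
      Tendsto (fun t : ℝ => pstarF m qinf ϑ₀ t - m * t / (2 * qinf)) atTop (𝓝 P₀) ∧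
      ∀ t : ℝ, 0 ≤ t →
        |thetaF m qinf ϑ₀ t| ≤ C₁ / (1 + t) ∧
        |pstarF m qinf ϑ₀ t - (P₀ + m * t / (2 * qinf))| ≤ C₁ / (t + 1) ∧
        |qstarF m qinf ϑ₀ t - qinf| ≤ C₁ / (t + 1) ^ 2 ∧
        |pstarF m qinf ϑ₀ t| / (t + 1) ≤ C₁ ∧
        |deriv (pstarF m qinf ϑ₀) t| ≤ C₁ ∧
        |qstarF m qinf ϑ₀ t| ≤ C₁ ∧
        (t + 1) ^ 3 * |deriv (qstarF m qinf ϑ₀) t| ≤ C₁ := by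
  set a := m / (4 * qinf ^ 2) with ha_def
  set c := Real.cot (2 * ϑ₀) with hc_def
  have ha : 0 < a := by positivity
  obtain ⟨K, hK⟩ : ∃ K, K = (1 + (a - c) ^ 2) / (2 * a) := ⟨_, rfl⟩
  have hK0 : 0 < K := by rw [hK]; positivity
  have htan : ∀ t : ℝ, 0 ≤ t → Real.tan (thetaF m qinf ϑ₀ t) ≤ K / (t + 1) := fun t ht => by
    rw [hK]
    exact tan_thetaF_le hm hq ϑ₀ ht
  have hp : ∀ t : ℝ, 0 ≤ t →
      |pstarF m qinf ϑ₀ t - (2 * qinf * c + m * t / (2 * qinf))| ≤ 2 * qinf * K / (t + 1) :=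
    fun t ht => (abs_pstarF_sub_le hq m ϑ₀ t).trans <| by
      rw [mul_div_assoc]
      exact mul_le_mul_of_nonneg_left (htan t ht) (by positivity)
  have hqs : ∀ t : ℝ, 0 ≤ t →
      |qstarF m qinf ϑ₀ t - qinf| ≤ qinf * K ^ 2 / (t + 1) ^ 2 :=
    fun t ht => (abs_qstarF_sub_le hq m ϑ₀ t).trans <| by
      rw [mul_div_assoc, ← div_pow]
      have := tan_thetaF_pos m qinf ϑ₀ t
      gcongr
      exact htan t ht
  obtain ⟨C, hC⟩ : ∃ C, C = K + 2 * qinf * K + (qinf + qinf * K ^ 2) +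
      2 * qinf * (|c| + a) + 2 * a * qinf + 2 * a * qinf * K ^ 3 := ⟨_, rfl⟩
  have h₁ : 0 < 2 * qinf * K := by positivity
  have h₂ : 0 < qinf * K ^ 2 := by positivity
  have h₃ : 0 < 2 * qinf * (|c| + a) := by positivity
  have h₄ : 0 < 2 * a * qinf := by positivity
  have h₅ : 0 < 2 * a * qinf * K ^ 3 := by positivity
  refine ⟨C, by linarith, 2 * qinf * c, ?_, fun t ht => ?_⟩
  · rw [tendsto_iff_norm_sub_tendsto_zero]
    refine squeeze_zero' (Eventually.of_forall fun _ => norm_nonneg _)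
      ((eventually_ge_atTop 0).mono fun t ht => ?_)
      ((tendsto_atTop_add_const_right atTop (1 : ℝ) tendsto_id).const_div_atTop (2 * qinf * K))
    rw [Real.norm_eq_abs, sub_sub, add_comm (m * t / (2 * qinf))]
    exact hp t ht
  have hS : 0 < t + 1 := by linarith
  have hu := htan t ht
  obtain ⟨hθ₀, hθ₁⟩ := thetaF_mem_Ioo m qinf ϑ₀ t
  have hs := sin_thetaF_pos m qinf ϑ₀ t
  have hk := cos_thetaF_pos m qinf ϑ₀ t
  refine ⟨?_, (hp t ht).trans ?_, (hqs t ht).trans ?_, ?_, ?_, ?_, ?_⟩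
  · rw [abs_of_pos hθ₀, add_comm 1 t]
    refine (Real.le_tan hθ₀.le hθ₁).trans (hu.trans ?_)
    gcongr
    linarith
  · gcongr
    linarith
  · gcongr
    linarith
  · rw [div_le_iff₀ hS]
    have hlin : m * t / (2 * qinf) = 2 * qinf * a * t := by
      rw [ha_def]
      field_simp
      ring
    have h := hp t ht
    rw [hlin] at h
    have hle : 2 * qinf * K / (t + 1) ≤ 2 * qinf * K :=
      div_le_self h₁.le (by linarith)
    have hlead : |2 * qinf * c + 2 * qinf * a * t| ≤ 2 * qinf * |c| + 2 * qinf * a * t := by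
      refine (abs_add_le _ _).trans (le_of_eq ?_)
      rw [abs_mul, abs_of_pos (by positivity : 0 < 2 * qinf),
        abs_of_nonneg (by positivity : 0 ≤ 2 * qinf * a * t)]
    have htri := abs_sub_abs_le_abs_sub (pstarF m qinf ϑ₀ t) (2 * qinf * c + 2 * qinf * a * t)
    have hct : 0 ≤ 2 * qinf * |c| * t := by positivity
    have hqa : 0 < 2 * qinf * a := by positivity
    have hbound : 2 * qinf * K + 2 * qinf * (|c| + a) ≤ C := by linarith
    have hKt : 0 ≤ 2 * qinf * K * t := by positivity
    have := mul_le_mul_of_nonneg_right hbound hS.le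
    linarith
  · rw [(hasDerivAt_pstarF m qinf ϑ₀ t).deriv, abs_of_nonneg (by positivity)]
    have : Real.cos (thetaF m qinf ϑ₀ t) ^ 3 ≤ 1 := pow_le_one₀ hk.le (Real.cos_le_one _)
    have := mul_le_of_le_one_right h₄.le this
    linarith
  · have hle : qinf * K ^ 2 / (t + 1) ^ 2 ≤ qinf * K ^ 2 :=
      div_le_self h₂.le (one_le_pow₀ (by linarith))
    have htri := abs_sub_abs_le_abs_sub (qstarF m qinf ϑ₀ t) qinf
    rw [abs_of_pos hq] at htri
    linarith [hqs t ht]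
  · rw [(hasDerivAt_qstarF m qinf ϑ₀ t).deriv, abs_neg, abs_of_nonneg (by positivity)]
    have hle : (t + 1) * Real.sin (thetaF m qinf ϑ₀ t) ≤ K := by
      rw [mul_comm, ← le_div_iff₀ hS]
      exact (sin_thetaF_le_tan m qinf ϑ₀ t).trans hu
    calc (t + 1) ^ 3 * (2 * a * qinf * Real.sin (thetaF m qinf ϑ₀ t) ^ 3)
        = 2 * a * qinf * ((t + 1) * Real.sin (thetaF m qinf ϑ₀ t)) ^ 3 := by ring
      _ ≤ 2 * a * qinf * K ^ 3 := by gcongr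
      _ ≤ C := by linarith
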